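/- arXiv:2502.06526 — 2 statements merged into one kernel-verified Lean document; each statement's English description precedes it below -/
import Mathlib

section
/- Let n be a positive integer, ρ a density matrix on the bipartite system R⊗A, σ a density matrix on A, and ω a density matrix on R. For each x ∈ {1,…,n} let τ_x be the density matrix on R⊗A₁⊗…⊗A_n (each A_i a copy of A) given by τ_x = ρ^{RA_x} ⊗ (⊗_{i≠x} σ^{A_i}), and let τ = (1/n) Σ_{x=1}^n τ_x. Then Q₂(τ ‖ ω ⊗ σ^{⊗n}) = ((n−1)/n)·Q₂(ρ^R ‖ ω) + (1/n)·Q₂(ρ^{RA} ‖ ω ⊗ σ), where ρ^R = Tr_A ρ. -/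
open scoped Matrix Kronecker BigOperators ENNReal ComplexOrder Classical

noncomputable section

variable {d : Type*} [Fintype d] [DecidableEq d]

/-- Apply a real function to the eigenvalues of a Hermitian matrix (spectral
functional calculus). -/
def herFun {A : Matrix d d ℂ} (hA : A.IsHermitian) (f : ℝ → ℝ) : Matrix d d ℂ :=
  (hA.eigenvectorUnitary : Matrix d d ℂ) *
    Matrix.diagonal (fun i => (f (hA.eigenvalues i) : ℂ)) *
    (hA.eigenvectorUnitary : Matrix d d ℂ)ᴴ

/-- Functional calculus, extended by the junk value `0` to non-Hermitian matrices. -/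
def matFun (A : Matrix d d ℂ) (f : ℝ → ℝ) : Matrix d d ℂ :=
  if h : A.IsHermitian then herFun h f else 0

/-- Real power of a Hermitian matrix, taken on its support (Moore–Penrose
convention: zero eigenvalues are sent to zero; negative powers are pseudo-inverses). -/
def matPow (A : Matrix d d ℂ) (r : ℝ) : Matrix d d ℂ :=
  matFun A (fun x => if x = 0 then 0 else Real.rpow x r)

/-- Logarithm of a Hermitian matrix on its support. -/
def matLog (A : Matrix d d ℂ) : Matrix d d ℂ := matFun A Real.log

/-- A density matrix: positive semidefinite with unit trace. -/
def IsDensity (A : Matrix d d ℂ) : Prop := A.PosSemidef ∧ A.trace = 1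

/-- `suppLE ρ σ` : the support of `ρ` is contained in the support of `σ`
(for Hermitian matrices this is equivalent to `ker σ ≤ ker ρ`). -/
def suppLE (ρ σ : Matrix d d ℂ) : Prop :=
  LinearMap.ker σ.mulVecLin ≤ LinearMap.ker ρ.mulVecLin

/-- Trace (nuclear) norm of a matrix: `Tr √(AᴴA)`. -/
def traceNorm (A : Matrix d d ℂ) : ℝ := (Matrix.trace (matPow (Aᴴ * A) (1/2))).re

/-- The real-valued collision quantity `Tr[ρ σ^{-1/2} ρ σ^{-1/2}]`. -/
def Q2R (ρ σ : Matrix d d ℂ) : ℝ :=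
  (Matrix.trace (ρ * matPow σ (-(1/2)) * ρ * matPow σ (-(1/2)))).re

/-- `Q₂(ρ‖σ) = Tr[ρ σ^{-1/2} ρ σ^{-1/2}]`, equal to `+∞` unless `supp ρ ⊆ supp σ`. -/
def Q2 (ρ σ : Matrix d d ℂ) : ℝ≥0∞ :=
  if suppLE ρ σ then ENNReal.ofReal (Q2R ρ σ) else ∞

/-- Collision relative entropy `D₂(ρ‖σ) = log Q₂(ρ‖σ)`. -/
def D2 (ρ σ : Matrix d d ℂ) : EReal := ENNReal.log (Q2 ρ σ)

/-- Fidelity `F(ρ,σ) = ‖√ρ √σ‖₁`. -/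
def fidelity (ρ σ : Matrix d d ℂ) : ℝ := traceNorm (matPow ρ (1/2) * matPow σ (1/2))

/-- Purified distance `P(ρ,σ) = √(1 - F(ρ,σ)²)`. -/
def purifiedDist (ρ σ : Matrix d d ℂ) : ℝ := Real.sqrt (1 - fidelity ρ σ ^ 2)

variable {R A : Type*} [Fintype R] [DecidableEq R] [Fintype A] [DecidableEq A]

/-- Partial trace over the second tensor factor. -/
def ptrace2 (ρ : Matrix (R × A) (R × A) ℂ) : Matrix R R ℂ :=
  Matrix.of fun i j => ∑ a : A, ρ (i, a) (j, a)

/-- `n`-fold tensor power `σ^{⊗n}` of a matrix `σ`. -/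
def tpow (σ : Matrix A A ℂ) (n : ℕ) : Matrix (Fin n → A) (Fin n → A) ℂ :=
  Matrix.of fun v w => ∏ k, σ (v k) (w k)

/-- The state `τ_x = ρ^{R A_x} ⊗ (⊗_{i ≠ x} σ^{A_i})` on `R ⊗ A₁ ⊗ ⋯ ⊗ A_n`. -/
def tauX (ρ : Matrix (R × A) (R × A) ℂ) (σ : Matrix A A ℂ) (n : ℕ) (x : Fin n) :
    Matrix (R × (Fin n → A)) (R × (Fin n → A)) ℂ :=
  Matrix.of fun p q =>
    ρ (p.1, p.2 x) (q.1, q.2 x) * ∏ k ∈ Finset.univ.erase x, σ (p.2 k) (q.2 k)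

/-! Spectral calculus helpers -/

theorem herFun_eq {A : Matrix d d ℂ} (hA : A.IsHermitian) (f : ℝ → ℝ)
    (U : Matrix d d ℂ) (hU : U * Uᴴ = 1) (e : d → ℝ)
    (h : A = U * Matrix.diagonal (fun i => (e i : ℂ)) * Uᴴ) :
    matFun A f = U * Matrix.diagonal (fun i => (f (e i) : ℂ)) * Uᴴ := by
  rw [matFun, dif_pos hA, herFun]
  set V : Matrix d d ℂ := (hA.eigenvectorUnitary : Matrix d d ℂ) with hV
  have hU' : Uᴴ * U = 1 := mul_eq_one_comm.mp hU
  have hVV : V * Vᴴ = 1 := by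
    have := Unitary.mul_star_self_of_mem hA.eigenvectorUnitary.2
    simpa [Matrix.star_eq_conjTranspose] using this
  have hVV' : Vᴴ * V = 1 := mul_eq_one_comm.mp hVV
  have hs : A = V * Matrix.diagonal (fun i => (hA.eigenvalues i : ℂ)) * Vᴴ := by
    have := hA.spectral_theorem
    rw [Unitary.conjStarAlgAut_apply] at this
    exact this
  set M := Vᴴ * U with hM
  have key : M * Matrix.diagonal (fun i => (e i : ℂ))
      = Matrix.diagonal (fun i => (hA.eigenvalues i : ℂ)) * M := by
    have h1 : Vᴴ * A * U = M * Matrix.diagonal (fun i => (e i : ℂ)) := by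
      conv_lhs => rw [h]
      simp only [hM, Matrix.mul_assoc, hU', Matrix.mul_one]
    have h2 : Vᴴ * A * U = Matrix.diagonal (fun i => (hA.eigenvalues i : ℂ)) * M := by
      conv_lhs => rw [hs]
      simp only [hM, ← Matrix.mul_assoc, hVV', Matrix.one_mul]
    rw [← h1, h2]
  have key2 : M * Matrix.diagonal (fun i => (f (e i) : ℂ))
      = Matrix.diagonal (fun i => (f (hA.eigenvalues i) : ℂ)) * M := by
    ext i j
    have := congrFun (congrFun key i) j
    rw [Matrix.mul_diagonal, Matrix.diagonal_mul] at this ⊢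
    by_cases hz : M i j = 0
    · simp [hz]
    · have : (e j : ℂ) = hA.eigenvalues i := by
        rw [mul_comm] at this
        exact mul_right_cancel₀ hz this
      have : e j = hA.eigenvalues i := by exact_mod_cast this
      rw [this, mul_comm]
  calc V * Matrix.diagonal (fun i => (f (hA.eigenvalues i) : ℂ)) * Vᴴ
      = V * (Matrix.diagonal (fun i => (f (hA.eigenvalues i) : ℂ)) * M) * Uᴴ := by
        simp only [hM, Matrix.mul_assoc, hU, Matrix.mul_one]
    _ = U * Matrix.diagonal (fun i => (f (e i) : ℂ)) * Uᴴ := by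
        rw [← key2]
        simp only [hM, ← Matrix.mul_assoc, hVV, Matrix.one_mul]

theorem exists_spec {A : Matrix d d ℂ} (hA : A.PosSemidef) :
    ∃ (U : Matrix d d ℂ) (e : d → ℝ), U * Uᴴ = 1 ∧ (∀ i, 0 ≤ e i) ∧
      A = U * Matrix.diagonal (fun i => (e i : ℂ)) * Uᴴ := by
  refine ⟨hA.1.eigenvectorUnitary, hA.1.eigenvalues, ?_, hA.eigenvalues_nonneg, ?_⟩
  · have := Unitary.mul_star_self_of_mem hA.1.eigenvectorUnitary.2
    simpa [Matrix.star_eq_conjTranspose] using this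
  · have := hA.1.spectral_theorem
    rw [Unitary.conjStarAlgAut_apply] at this
    exact this

theorem psd_factor {A : Matrix d d ℂ} (hA : A.PosSemidef) : ∃ B : Matrix d d ℂ, A = Bᴴ * B := by
  obtain ⟨U, e, hU, he, h⟩ := exists_spec hA
  refine ⟨Matrix.diagonal (fun i => (Real.sqrt (e i) : ℂ)) * Uᴴ, ?_⟩
  have h1 : (Matrix.diagonal (fun i => (Real.sqrt (e i) : ℂ)))ᴴ
      = Matrix.diagonal (fun i => (Real.sqrt (e i) : ℂ)) := by
    rw [Matrix.diagonal_conjTranspose]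
    congr 1
    funext i
    simp
  have h2 : Matrix.diagonal (fun i => (e i : ℂ)) = Matrix.diagonal (fun i => (Real.sqrt (e i) : ℂ))
      * Matrix.diagonal (fun i => (Real.sqrt (e i) : ℂ)) := by
    rw [Matrix.diagonal_mul_diagonal]
    congr 1
    funext i
    exact_mod_cast (Real.mul_self_sqrt (he i)).symm
  rw [Matrix.conjTranspose_mul, h1, Matrix.conjTranspose_conjTranspose, h, h2]
  simp only [Matrix.mul_assoc]

/-- the scalar function x ↦ x^(-1/2) -/
def ihalf (x : ℝ) : ℝ := if x = 0 then 0 else Real.rpow x (-(1/2))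

theorem ihalf_nonneg {x : ℝ} (hx : 0 ≤ x) : 0 ≤ ihalf x := by
  unfold ihalf; split_ifs
  · exact le_rfl
  · exact Real.rpow_nonneg hx _

theorem ihalf_one : ihalf 1 = 1 := by simp [ihalf]

theorem ihalf_mul {x y : ℝ} (hx : 0 ≤ x) (hy : 0 ≤ y) : ihalf (x * y) = ihalf x * ihalf y := by
  unfold ihalf
  by_cases h1 : x = 0
  · simp [h1]
  by_cases h2 : y = 0
  · simp [h2]
  rw [if_neg h1, if_neg h2, if_neg (mul_ne_zero h1 h2)]
  exact Real.mul_rpow hx hy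

theorem ihalf_prod {ι : Type*} (s : Finset ι) (g : ι → ℝ) (hg : ∀ i, 0 ≤ g i) :
    ihalf (∏ i ∈ s, g i) = ∏ i ∈ s, ihalf (g i) := by
  induction s using Finset.induction_on with
  | empty => simp [ihalf_one]
  | insert a s ha ih =>
    rw [Finset.prod_insert ha, Finset.prod_insert ha,
      ihalf_mul (hg a) (Finset.prod_nonneg fun i _ => hg i), ih]

theorem ihalf_id {x : ℝ} (hx : 0 ≤ x) : x * ihalf x * (x * ihalf x) = x := by
  unfold ihalf
  by_cases h : x = 0
  · simp [h]
  · rw [if_neg h]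
    have hp : 0 < x := lt_of_le_of_ne hx (Ne.symm h)
    have h2 : Real.rpow x (-(1/2)) * Real.rpow x (-(1/2)) = x⁻¹ := by
      change x ^ (-(1/2) : ℝ) * x ^ (-(1/2) : ℝ) = _
      rw [← Real.rpow_add hp, ← Real.rpow_neg_one]; norm_num
    calc _ = x * x * (Real.rpow x (-(1/2)) * Real.rpow x (-(1/2))) := by ring
      _ = x := by rw [h2]; field_simp

theorem matPow_eq {A : Matrix d d ℂ} (hA : A.IsHermitian)
    (U : Matrix d d ℂ) (hU : U * Uᴴ = 1) (e : d → ℝ)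
    (h : A = U * Matrix.diagonal (fun i => (e i : ℂ)) * Uᴴ) :
    matPow A (-(1/2)) = U * Matrix.diagonal (fun i => (ihalf (e i) : ℂ)) * Uᴴ :=
  herFun_eq hA ihalf U hU e h

theorem conj_diag_mul {U : Matrix d d ℂ} (hU : U * Uᴴ = 1) (a b : d → ℂ) :
    (U * Matrix.diagonal a * Uᴴ) * (U * Matrix.diagonal b * Uᴴ)
      = U * Matrix.diagonal (fun i => a i * b i) * Uᴴ := by
  have hU' : Uᴴ * U = 1 := mul_eq_one_comm.mp hU
  rw [← Matrix.diagonal_mul_diagonal]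
  calc _ = U * Matrix.diagonal a * (Uᴴ * U) * Matrix.diagonal b * Uᴴ := by
        simp only [Matrix.mul_assoc]
    _ = _ := by rw [hU']; simp only [Matrix.mul_assoc, Matrix.mul_one]

theorem matPow_props {A : Matrix d d ℂ} (hA : A.PosSemidef) :
    (matPow A (-(1/2))).PosSemidef ∧
    A * matPow A (-(1/2)) = matPow A (-(1/2)) * A ∧
    A * matPow A (-(1/2)) * (A * matPow A (-(1/2))) = A := by
  obtain ⟨U, e, hU, he, h⟩ := exists_spec hA
  have h2 := matPow_eq hA.1 U hU e h
  rw [h2]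
  refine ⟨?_, ?_, ?_⟩
  · apply Matrix.PosSemidef.mul_mul_conjTranspose_same
    rw [Matrix.posSemidef_diagonal_iff]
    intro i
    exact_mod_cast ihalf_nonneg (he i)
  · conv_lhs => rw [h]
    conv_rhs => rw [h]
    rw [conj_diag_mul hU, conj_diag_mul hU]
    simp only [mul_comm]
  · conv_lhs => rw [h]
    rw [conj_diag_mul hU, conj_diag_mul hU]
    conv_rhs => rw [h]
    congr 2
    congr 1
    funext i
    exact_mod_cast ihalf_id (he i)

/-- Support projector. -/
def sproj (A : Matrix d d ℂ) : Matrix d d ℂ :=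
  matPow A (-(1/2)) * A * matPow A (-(1/2))

theorem sproj_eq {A : Matrix d d ℂ} (hA : A.PosSemidef) :
    sproj A = matPow A (-(1/2)) * matPow A (-(1/2)) * A := by
  rw [sproj, Matrix.mul_assoc, Matrix.mul_assoc, (matPow_props hA).2.1]

theorem mul_sproj {A : Matrix d d ℂ} (hA : A.PosSemidef) : A * sproj A = A := by
  conv_rhs => rw [← (matPow_props hA).2.2]
  rw [sproj]; simp only [Matrix.mul_assoc]

theorem sproj_herm {A : Matrix d d ℂ} (hA : A.PosSemidef) : (sproj A)ᴴ = sproj A := by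
  have := (matPow_props hA).1.1
  have h1 : (matPow A (-(1/2)))ᴴ = matPow A (-(1/2)) := this
  have h2 : Aᴴ = A := hA.1
  rw [sproj]
  simp only [Matrix.conjTranspose_mul, h1, h2, Matrix.mul_assoc]

theorem sproj_idem {A : Matrix d d ℂ} (hA : A.PosSemidef) : sproj A * sproj A = sproj A := by
  conv_lhs => rw [sproj_eq hA, Matrix.mul_assoc, ← sproj_eq hA, mul_sproj hA]
  rw [sproj_eq hA]

theorem suppLE_iff {ρ A : Matrix d d ℂ} (hA : A.PosSemidef) :
    suppLE ρ A ↔ ρ * sproj A = ρ := by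
  constructor
  · intro h
    apply Matrix.toLin'.injective
    ext1 i
    ext1
    simp only [LinearMap.comp_apply, Matrix.toLin'_apply]
    set v := (LinearMap.single ℂ (fun _ : d => ℂ) i) 1
    have h0 : v - (sproj A).mulVec v ∈ LinearMap.ker A.mulVecLin := by
      simp [Matrix.mulVec_sub, Matrix.mulVec_mulVec, mul_sproj hA]
    have h1 := h h0
    simp only [LinearMap.mem_ker, Matrix.mulVecLin_apply, Matrix.mulVec_sub,
      Matrix.mulVec_mulVec, sub_eq_zero] at h1
    exact h1.symm
  · intro h v hv
    simp only [LinearMap.mem_ker, Matrix.mulVecLin_apply] at hv ⊢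
    rw [← h, sproj_eq hA, ← Matrix.mulVec_mulVec, ← Matrix.mulVec_mulVec, hv]
    simp

theorem proj_of_trace {ρ Q : Matrix d d ℂ} (hρ : ρ.PosSemidef) (hQ : Qᴴ = Q) (hQ2 : Q * Q = Q)
    (h : (ρ * Q).trace = ρ.trace) : ρ * Q = ρ := by
  obtain ⟨B, hB⟩ := psd_factor hρ
  have hX : ((B * (1 - Q))ᴴ * (B * (1 - Q))).trace = 0 := by
    have : (B * (1 - Q))ᴴ * (B * (1 - Q)) = (1 - Q) * (ρ * (1 - Q)) := by
      rw [hB]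
      simp only [Matrix.conjTranspose_mul, Matrix.conjTranspose_sub, Matrix.conjTranspose_one, hQ,
        Matrix.mul_assoc]
    rw [this, Matrix.trace_mul_comm, Matrix.mul_assoc]
    have : (1 - Q) * (1 - Q) = 1 - Q := by
      simp [Matrix.mul_sub, Matrix.sub_mul, hQ2]
    rw [this, Matrix.mul_sub, Matrix.trace_sub, Matrix.mul_one, h, sub_self]
  rw [Matrix.trace_conjTranspose_mul_self_eq_zero_iff] at hX
  have : ρ * (1 - Q) = 0 := by rw [hB, Matrix.mul_assoc, hX, Matrix.mul_zero]
  rw [Matrix.mul_sub, Matrix.mul_one, sub_eq_zero] at this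
  exact this.symm

theorem Q2R_nonneg {ρ A : Matrix d d ℂ} (hρ : ρ.PosSemidef) (hA : A.PosSemidef) :
    0 ≤ Q2R ρ A := by
  obtain ⟨B, hB⟩ := psd_factor (matPow_props hA).1
  have hh : ρᴴ = ρ := hρ.1
  have : (ρ * matPow A (-(1/2)) * ρ * matPow A (-(1/2))).trace
      = ((B * ρ * Bᴴ)ᴴ * (B * ρ * Bᴴ)).trace := by
    rw [hB]
    simp only [Matrix.conjTranspose_mul, hh, Matrix.conjTranspose_conjTranspose]
    rw [show ρ * (Bᴴ * B) * ρ * (Bᴴ * B) = (ρ * (Bᴴ * B) * ρ * Bᴴ) * B by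
      simp only [Matrix.mul_assoc], Matrix.trace_mul_comm]
    simp only [Matrix.mul_assoc]
  rw [Q2R, this]
  have := (Matrix.posSemidef_conjTranspose_mul_self (B * ρ * Bᴴ)).trace_nonneg
  exact (Complex.le_def.mp this).1

/-! Tensor powers -/

theorem sum_prod_fun {ι α : Type*} [Fintype ι] [DecidableEq ι] [Fintype α] (F : ι → α → ℂ) :
    ∑ v : ι → α, ∏ k, F k (v k) = ∏ k, ∑ a, F k a := by
  rw [Finset.prod_univ_sum]; simp

theorem tpow_mul (M N : Matrix A A ℂ) (n : ℕ) : tpow M n * tpow N n = tpow (M * N) n := by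
  ext v w
  simp only [Matrix.mul_apply, tpow, Matrix.of_apply, ← Finset.prod_mul_distrib]
  exact sum_prod_fun (fun k a => M (v k) a * N a (w k))

theorem tpow_conj (M : Matrix A A ℂ) (n : ℕ) : (tpow M n)ᴴ = tpow Mᴴ n := by
  ext v w
  simp [Matrix.conjTranspose_apply, tpow]

theorem tpow_diag (e : A → ℂ) (n : ℕ) :
    tpow (Matrix.diagonal e) n = Matrix.diagonal (fun v => ∏ k, e (v k)) := by
  ext v w
  simp only [tpow, Matrix.of_apply, Matrix.diagonal_apply]
  split_ifs with h
  · subst h; simp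
  · obtain ⟨k, hk⟩ := Function.ne_iff.mp h
    exact Finset.prod_eq_zero (Finset.mem_univ k) (if_neg hk)

theorem tpow_one (n : ℕ) : tpow (1 : Matrix A A ℂ) n = 1 := by
  rw [← Matrix.diagonal_one, tpow_diag]; simp

theorem tpow_psd_pow {σ : Matrix A A ℂ} (hσ : σ.PosSemidef) (n : ℕ) :
    (tpow σ n).PosSemidef ∧ matPow (tpow σ n) (-(1/2)) = tpow (matPow σ (-(1/2))) n := by
  obtain ⟨U, e, hU, he, h⟩ := exists_spec hσ
  have hd : tpow σ n = tpow U n * Matrix.diagonal (fun v => ((∏ k, e (v k) : ℝ) : ℂ)) *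
      (tpow U n)ᴴ := by
    conv_lhs => rw [h]
    rw [← tpow_mul, ← tpow_mul, tpow_diag, tpow_conj]
    push_cast; rfl
  have hp : (tpow σ n).PosSemidef := by
    rw [hd]
    apply Matrix.PosSemidef.mul_mul_conjTranspose_same
    rw [Matrix.posSemidef_diagonal_iff]
    intro i
    exact_mod_cast Finset.prod_nonneg fun k _ => he (i k)
  refine ⟨hp, ?_⟩
  rw [matPow_eq hp.1 (tpow U n) (by rw [tpow_conj, tpow_mul, hU, tpow_one]) _ hd,
    matPow_eq hσ.1 U hU e h, ← tpow_mul, ← tpow_mul, tpow_diag, tpow_conj]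
  congr 2
  congr 1
  funext v
  rw [ihalf_prod _ _ (fun k => he (v k))]
  push_cast; rfl

theorem kron_pow {R B : Type*} [Fintype R] [DecidableEq R] [Fintype B] [DecidableEq B]
    {ω : Matrix R R ℂ} {σ : Matrix B B ℂ} (hω : ω.PosSemidef) (hσ : σ.PosSemidef) :
    matPow (ω ⊗ₖ σ) (-(1/2)) = matPow ω (-(1/2)) ⊗ₖ matPow σ (-(1/2)) := by
  obtain ⟨U, e, hU, he, h⟩ := exists_spec hω
  obtain ⟨V, f, hV, hf, h'⟩ := exists_spec hσ
  have hd : ω ⊗ₖ σ = (U ⊗ₖ V) * Matrix.diagonal (fun p => ((e p.1 * f p.2 : ℝ) : ℂ)) *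
      (U ⊗ₖ V)ᴴ := by
    conv_lhs => rw [h, h']
    rw [Matrix.mul_kronecker_mul, Matrix.mul_kronecker_mul, Matrix.diagonal_kronecker_diagonal,
      Matrix.conjTranspose_kronecker]
    push_cast; rfl
  rw [matPow_eq (hω.kronecker hσ).1 (U ⊗ₖ V) (by
      rw [Matrix.conjTranspose_kronecker, ← Matrix.mul_kronecker_mul, hU, hV,
        Matrix.one_kronecker_one]) _ hd,
    matPow_eq hω.1 U hU e h, matPow_eq hσ.1 V hV f h', Matrix.mul_kronecker_mul,
    Matrix.mul_kronecker_mul, Matrix.diagonal_kronecker_diagonal, Matrix.conjTranspose_kronecker]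
  congr 2
  congr 1
  funext p
  rw [ihalf_mul (he _) (hf _)]
  push_cast; rfl

/-! Algebra of `tauX` -/

theorem prod_ite_erase {n : ℕ} (x : Fin n) (f : ℂ) (g : Fin n → ℂ) :
    (∏ k, if k = x then f else g k) = f * ∏ k ∈ Finset.univ.erase x, g k := by
  rw [← Finset.mul_prod_erase _ _ (Finset.mem_univ x), if_pos rfl]
  congr 1
  exact Finset.prod_congr rfl fun k hk => if_neg (Finset.ne_of_mem_erase hk)

theorem tauX_mul (M M' : Matrix (R × A) (R × A) ℂ) (N N' : Matrix A A ℂ) (n : ℕ) (x : Fin n) :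
    tauX M N n x * tauX M' N' n x = tauX (M * M') (N * N') n x := by
  ext p q
  simp only [tauX, Matrix.mul_apply, Matrix.of_apply, Fintype.sum_prod_type, Finset.sum_mul]
  refine Finset.sum_congr rfl fun r _ => ?_
  have := sum_prod_fun (fun (k : Fin n) (a : A) =>
    if k = x then M (p.1, p.2 x) (r, a) * M' (r, a) (q.1, q.2 x)
      else N (p.2 k) a * N' a (q.2 k))
  have h2 : ∀ k : Fin n, (∑ a, if k = x then M (p.1, p.2 x) (r, a) * M' (r, a) (q.1, q.2 x)
      else N (p.2 k) a * N' a (q.2 k)) = if k = x then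
        (∑ a, M (p.1, p.2 x) (r, a) * M' (r, a) (q.1, q.2 x))
        else ∑ a, N (p.2 k) a * N' a (q.2 k) := by
    intro k; split_ifs <;> rfl
  rw [Finset.prod_congr rfl (fun k _ => h2 k), prod_ite_erase, Finset.sum_mul] at this
  rw [← this]
  refine Finset.sum_congr rfl fun v _ => ?_
  have h3 : ∀ k : Fin n, (if k = x then M (p.1, p.2 x) (r, v k) * M' (r, v k) (q.1, q.2 x)
      else N (p.2 k) (v k) * N' (v k) (q.2 k)) =
      if k = x then M (p.1, p.2 x) (r, v x) * M' (r, v x) (q.1, q.2 x)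
      else N (p.2 k) (v k) * N' (v k) (q.2 k) := by
    intro k; split_ifs with h
    · rw [h]
    · rfl
  rw [Finset.prod_congr rfl (fun k _ => h3 k), prod_ite_erase, Finset.prod_mul_distrib]
  ring

theorem tauX_kron (W : Matrix R R ℂ) (S : Matrix A A ℂ) (n : ℕ) (x : Fin n) :
    W ⊗ₖ tpow S n = tauX (W ⊗ₖ S) S n x := by
  ext p q
  simp only [tauX, tpow, Matrix.of_apply, Matrix.kroneckerMap_apply]
  rw [← Finset.mul_prod_erase _ _ (Finset.mem_univ x), mul_assoc]

theorem tauX_trace (M : Matrix (R × A) (R × A) ℂ) (N : Matrix A A ℂ) (n : ℕ) (x : Fin n)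
    (hN : N.trace = 1) : (tauX M N n x).trace = M.trace := by
  simp only [tauX, Matrix.trace, Matrix.diag_apply, Matrix.of_apply, Fintype.sum_prod_type]
  refine Finset.sum_congr rfl fun r _ => ?_
  have := sum_prod_fun (fun (k : Fin n) (a : A) => if k = x then M (r, a) (r, a) else N a a)
  have h2 : ∀ k : Fin n, (∑ a, if k = x then M (r, a) (r, a) else N a a) = if k = x then
        (∑ a, M (r, a) (r, a)) else 1 := by
    intro k; split_ifs
    · rfl
    · exact hN
  rw [Finset.prod_congr rfl (fun k _ => h2 k), prod_ite_erase, Finset.prod_const_one,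
    mul_one] at this
  rw [← this]
  refine Finset.sum_congr rfl fun v _ => ?_
  have h3 : ∀ k : Fin n, (if k = x then M (r, v k) (r, v k) else N (v k) (v k)) =
      if k = x then M (r, v x) (r, v x) else N (v k) (v k) := by
    intro k; split_ifs with h
    · rw [h]
    · rfl
  rw [Finset.prod_congr rfl (fun k _ => h3 k), prod_ite_erase]

theorem prod_two {n : ℕ} {x y : Fin n} (hxy : x ≠ y) (g : Fin n → ℂ) :
    ∏ k, g k = g x * g y * ∏ k ∈ (Finset.univ.erase x).erase y, g k := by
  rw [← Finset.mul_prod_erase _ _ (Finset.mem_univ x),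
    ← Finset.mul_prod_erase (Finset.univ.erase x) g (a := y) (by simp [hxy.symm]), mul_assoc]

theorem tauX_cross (M : Matrix (R × A) (R × A) ℂ) (N : Matrix A A ℂ) (n : ℕ) {x y : Fin n}
    (hxy : x ≠ y) (hN : (N * N).trace = 1) :
    (tauX M N n x * tauX M N n y).trace =
      (ptrace2 (M * ((1 : Matrix R R ℂ) ⊗ₖ N)) * ptrace2 (M * ((1 : Matrix R R ℂ) ⊗ₖ N))).trace := by
  have hpt : ∀ r r', ptrace2 (M * ((1 : Matrix R R ℂ) ⊗ₖ N)) r r'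
      = ∑ a, ∑ b, M (r, a) (r', b) * N b a := by
    intro r r'
    simp only [ptrace2, Matrix.of_apply, Matrix.mul_apply, Fintype.sum_prod_type,
      Matrix.kroneckerMap_apply, Matrix.one_apply]
    refine Finset.sum_congr rfl fun a _ => ?_
    rw [Finset.sum_comm]
    refine Finset.sum_congr rfl fun b _ => ?_
    simp
  simp only [Matrix.trace, Matrix.diag_apply, Matrix.mul_apply, Fintype.sum_prod_type, hpt]
  refine Finset.sum_congr rfl fun r _ => ?_
  rw [Finset.sum_comm]
  refine Finset.sum_congr rfl fun r' _ => ?_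
  let F : Fin n → A × A → ℂ := fun k p =>
    if k = x then M (r, p.1) (r', p.2) * N p.2 p.1
    else if k = y then M (r', p.2) (r, p.1) * N p.1 p.2
    else N p.1 p.2 * N p.2 p.1
  have hF := sum_prod_fun F
  rw [prod_two hxy] at hF
  have hone : ∏ k ∈ (Finset.univ.erase x).erase y, ∑ p, F k p = 1 := by
    apply Finset.prod_eq_one
    intro k hk
    simp only [Finset.mem_erase, Finset.mem_univ, and_true] at hk
    simp only [F, if_neg hk.1, if_neg hk.2]
    rw [Fintype.sum_prod_type, ← hN]
    simp [Matrix.trace, Matrix.mul_apply]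
  rw [hone, mul_one] at hF
  have hx : ∑ p, F x p = ∑ a, ∑ b, M (r, a) (r', b) * N b a := by
    simp only [F, if_true]
    rw [Fintype.sum_prod_type]
  have hy : ∑ p, F y p = ∑ a, ∑ b, M (r', a) (r, b) * N b a := by
    simp only [F, if_neg hxy.symm, if_true]
    rw [Fintype.sum_prod_type, Finset.sum_comm]
  rw [hx, hy] at hF
  rw [← hF, ← (Equiv.arrowProdEquivProdArrow (Fin n) (fun _ => A) (fun _ => A)).symm.sum_comp,
    Fintype.sum_prod_type]
  refine Finset.sum_congr rfl fun v _ => ?_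
  refine Finset.sum_congr rfl fun w _ => ?_
  rw [prod_two hxy]
  have e1 : ∏ k ∈ Finset.univ.erase x, N (v k) (w k)
      = N (v y) (w y) * ∏ k ∈ (Finset.univ.erase x).erase y, N (v k) (w k) :=
    (Finset.mul_prod_erase _ _ (by simp [hxy.symm])).symm
  have e2 : ∏ k ∈ Finset.univ.erase y, N (w k) (v k)
      = N (w x) (v x) * ∏ k ∈ (Finset.univ.erase x).erase y, N (w k) (v k) := by
    rw [Finset.erase_right_comm]
    exact (Finset.mul_prod_erase _ _ (by simp [hxy])).symm
  have e3 : ∏ k ∈ (Finset.univ.erase x).erase y, F k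
      ((Equiv.arrowProdEquivProdArrow (Fin n) (fun _ => A) (fun _ => A)).symm (v, w) k)
      = ∏ k ∈ (Finset.univ.erase x).erase y, (N (v k) (w k) * N (w k) (v k)) := by
    apply Finset.prod_congr rfl
    intro k hk
    simp only [Finset.mem_erase, Finset.mem_univ, and_true] at hk
    simp only [F, if_neg hk.1, if_neg hk.2]
    rfl
  rw [e3, Finset.prod_mul_distrib]
  simp only [tauX, Matrix.of_apply, e1, e2, F, if_neg hxy.symm, if_true]
  simp only [Equiv.arrowProdEquivProdArrow, Equiv.coe_fn_symm_mk]
  ring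

theorem ptrace2_mul_kron (M : Matrix (R × A) (R × A) ℂ) (W : Matrix R R ℂ) :
    ptrace2 (M * (W ⊗ₖ (1 : Matrix A A ℂ))) = ptrace2 M * W := by
  ext i j
  simp only [ptrace2, Matrix.of_apply, Matrix.mul_apply, Fintype.sum_prod_type,
    Matrix.kroneckerMap_apply, Matrix.one_apply, Finset.sum_mul]
  rw [Finset.sum_comm]
  refine Finset.sum_congr rfl fun r _ => ?_
  refine Finset.sum_congr rfl fun a _ => ?_
  simp

theorem ptrace2_psd {M : Matrix (R × A) (R × A) ℂ} (hM : M.PosSemidef) :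
    (ptrace2 M).PosSemidef := by
  have : ptrace2 M = ∑ a : A, M.submatrix (fun r => (r, a)) (fun r => (r, a)) := by
    ext i j
    simp [ptrace2, Matrix.sum_apply]
  rw [this]
  exact Matrix.posSemidef_sum _ fun a _ => hM.submatrix _

theorem sproj_kron {R B : Type*} [Fintype R] [DecidableEq R] [Fintype B] [DecidableEq B]
    {ω : Matrix R R ℂ} {σ : Matrix B B ℂ} (hω : ω.PosSemidef) (hσ : σ.PosSemidef) :
    sproj (ω ⊗ₖ σ) = sproj ω ⊗ₖ sproj σ := by
  rw [sproj, kron_pow hω hσ, sproj, sproj]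
  simp only [Matrix.mul_kronecker_mul]

theorem sproj_tpow {σ : Matrix A A ℂ} (hσ : σ.PosSemidef) (n : ℕ) :
    sproj (tpow σ n) = tpow (sproj σ) n := by
  rw [sproj, (tpow_psd_pow hσ n).2, sproj, tpow_mul, tpow_mul]

theorem tau_trace_real (n : ℕ) (hn : 0 < n) (a b : ℂ) (f : Fin n → Fin n → ℂ)
    (h1 : ∀ x, f x x = a) (h2 : ∀ x y, x ≠ y → f x y = b) :
    (n : ℂ)⁻¹ * ((n : ℂ)⁻¹ * ∑ x, ∑ y, f x y) = (((n : ℝ) - 1) / n : ℝ) * b + ((1 / n : ℝ) : ℂ) * a := by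
  have : ∀ x y, f x y = b + if x = y then a - b else 0 := by
    intro x y
    by_cases h : x = y
    · subst h; simp [h1]
    · simp [h, h2 x y h]
  simp only [this, Finset.sum_add_distrib, Finset.sum_ite_eq, Finset.mem_univ, if_true,
    Finset.sum_const, Finset.card_univ, Fintype.card_fin, nsmul_eq_mul]
  have hn' : (n : ℂ) ≠ 0 := by exact_mod_cast hn.ne'
  push_cast
  field_simp
  ring

/-- **Equality-based convex split lemma.** -/
theorem convex_split_equality (n : ℕ) (hn : 0 < n)
    (ρ : Matrix (R × A) (R × A) ℂ) (hρ : IsDensity ρ)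
    (σ : Matrix A A ℂ) (hσ : IsDensity σ)
    (ω : Matrix R R ℂ) (hω : IsDensity ω) :
    Q2 ((n : ℂ)⁻¹ • ∑ x : Fin n, tauX ρ σ n x) (ω ⊗ₖ tpow σ n)
      = (((n : ℝ≥0∞) - 1) / n) * Q2 (ptrace2 ρ) ω
        + (1 / (n : ℝ≥0∞)) * Q2 ρ (ω ⊗ₖ σ) := by
  have hσp := hσ.1
  have hωp := hω.1
  have hρp := hρ.1
  have htp := (tpow_psd_pow hσp n).1
  have hK := hωp.kronecker htp
  have hk := hωp.kronecker hσp
  have hPK : sproj (ω ⊗ₖ tpow σ n) = sproj ω ⊗ₖ tpow (sproj σ) n := by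
    rw [sproj_kron hωp htp, sproj_tpow hσp]
  have hnC : (n : ℂ) ≠ 0 := by exact_mod_cast hn.ne'
  have hiff : suppLE ((n : ℂ)⁻¹ • ∑ x : Fin n, tauX ρ σ n x) (ω ⊗ₖ tpow σ n)
      ↔ suppLE ρ (ω ⊗ₖ σ) := by
    rw [suppLE_iff hK, suppLE_iff hk, hPK]
    have hterm : ∀ x, tauX ρ σ n x * (sproj ω ⊗ₖ tpow (sproj σ) n)
        = tauX (ρ * sproj (ω ⊗ₖ σ)) σ n x := by
      intro x
      rw [tauX_kron _ _ n x, tauX_mul, mul_sproj hσp, sproj_kron hωp hσp]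
    rw [Matrix.smul_mul, Finset.sum_mul, Finset.sum_congr rfl fun x _ => hterm x]
    constructor
    · intro h
      apply proj_of_trace hρp (sproj_herm hk) (sproj_idem hk)
      have h2 := congrArg Matrix.trace h
      simp only [Matrix.trace_smul, Matrix.trace_sum, tauX_trace _ _ n _ hσ.2, Finset.sum_const,
        Finset.card_univ, Fintype.card_fin, nsmul_eq_mul, smul_eq_mul] at h2
      rwa [inv_mul_cancel_left₀ hnC, inv_mul_cancel_left₀ hnC] at h2
    · intro h
      rw [h]
  have hn0 : (n : ℝ≥0∞) ≠ 0 := by exact_mod_cast hn.ne'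
  have hnt : (n : ℝ≥0∞) ≠ ∞ := ENNReal.natCast_ne_top n
  by_cases hs : suppLE ρ (ω ⊗ₖ σ)
  swap
  · rw [Q2, if_neg (fun h => hs (hiff.mp h)), Q2, Q2, if_neg hs, ENNReal.mul_top (by simp)]
    simp
  have hs1 : ρ * (sproj ω ⊗ₖ sproj σ) = ρ := by
    rw [← sproj_kron hωp hσp]; exact (suppLE_iff hk).mp hs
  have hsA : ρ * ((1 : Matrix R R ℂ) ⊗ₖ sproj σ) = ρ := by
    conv_lhs => rw [← hs1]
    rw [Matrix.mul_assoc, ← Matrix.mul_kronecker_mul, sproj_idem hσp, Matrix.mul_one, hs1]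
  have hsR : ρ * (sproj ω ⊗ₖ (1 : Matrix A A ℂ)) = ρ := by
    conv_lhs => rw [← hs1]
    rw [Matrix.mul_assoc, ← Matrix.mul_kronecker_mul, sproj_idem hωp, Matrix.mul_one, hs1]
  have hs2 : suppLE (ptrace2 ρ) ω := by
    rw [suppLE_iff hωp, ← ptrace2_mul_kron, hsR]
  rw [Q2, if_pos (hiff.mpr hs), Q2, if_pos hs2, Q2, if_pos hs]
  have hNN : (σ * matPow σ (-(1/2)) * (σ * matPow σ (-(1/2)))).trace = 1 := by
    rw [(matPow_props hσp).2.2, hσ.2]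
  have hmain : Q2R ((n : ℂ)⁻¹ • ∑ x : Fin n, tauX ρ σ n x) (ω ⊗ₖ tpow σ n)
      = (((n : ℝ) - 1) / n) * Q2R (ptrace2 ρ) ω + (1 / n) * Q2R ρ (ω ⊗ₖ σ) := by
    have htr : (((n : ℂ)⁻¹ • ∑ x : Fin n, tauX ρ σ n x) * matPow (ω ⊗ₖ tpow σ n) (-(1/2)) *
        ((n : ℂ)⁻¹ • ∑ x : Fin n, tauX ρ σ n x) * matPow (ω ⊗ₖ tpow σ n) (-(1/2))).trace
        = (((n : ℝ) - 1) / n : ℝ) *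
            (ptrace2 ρ * matPow ω (-(1/2)) * ptrace2 ρ * matPow ω (-(1/2))).trace
          + ((1 / n : ℝ) : ℂ) *
            (ρ * matPow (ω ⊗ₖ σ) (-(1/2)) * ρ * matPow (ω ⊗ₖ σ) (-(1/2))).trace := by
      rw [kron_pow hωp htp, (tpow_psd_pow hσp n).2, kron_pow hωp hσp]
      set W := matPow ω (-(1/2)) with hW
      set S := matPow σ (-(1/2)) with hS
      have hterm : ∀ x, tauX ρ σ n x * (W ⊗ₖ tpow S n) = tauX (ρ * (W ⊗ₖ S)) (σ * S) n x := by
        intro x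
        rw [tauX_kron _ _ n x, tauX_mul]
      have hT : ((n : ℂ)⁻¹ • ∑ x : Fin n, tauX ρ σ n x) * (W ⊗ₖ tpow S n)
          = (n : ℂ)⁻¹ • ∑ x, tauX (ρ * (W ⊗ₖ S)) (σ * S) n x := by
        rw [Matrix.smul_mul, Finset.sum_mul, Finset.sum_congr rfl fun x _ => hterm x]
      rw [Matrix.mul_assoc, hT, Matrix.smul_mul, Matrix.mul_smul, Matrix.trace_smul,
        Matrix.trace_smul, Finset.sum_mul_sum, Matrix.trace_sum, smul_eq_mul, smul_eq_mul]
      simp only [Matrix.trace_sum]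
      apply tau_trace_real n hn
      · intro x
        rw [tauX_mul, tauX_trace _ _ n x hNN]
        simp only [Matrix.mul_assoc]
      · intro x y hxy
        rw [tauX_cross _ _ n hxy hNN]
        have : ρ * (W ⊗ₖ S) * ((1 : Matrix R R ℂ) ⊗ₖ (σ * S)) = ρ * (W ⊗ₖ (1 : Matrix A A ℂ)) := by
          rw [Matrix.mul_assoc, ← Matrix.mul_kronecker_mul, Matrix.mul_one, ← Matrix.mul_assoc]
          change ρ * (W ⊗ₖ sproj σ) = _
          conv_rhs => rw [← hsA]
          rw [Matrix.mul_assoc, ← Matrix.mul_kronecker_mul, Matrix.mul_one, Matrix.one_mul]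
        rw [this, ptrace2_mul_kron]
        simp only [Matrix.mul_assoc]
    unfold Q2R
    rw [htr, Complex.add_re, Complex.re_ofReal_mul, Complex.re_ofReal_mul]
  have hnR : (0 : ℝ) < n := by exact_mod_cast hn
  have hn1 : (1 : ℝ) ≤ n := by exact_mod_cast hn
  have hc : (0 : ℝ) ≤ ((n : ℝ) - 1) / n := div_nonneg (by linarith) hnR.le
  have hc' : (0 : ℝ) ≤ 1 / n := by positivity
  rw [hmain, ENNReal.ofReal_add (mul_nonneg hc (Q2R_nonneg (ptrace2_psd hρp) hωp))
    (mul_nonneg hc' (Q2R_nonneg hρp hk)), ENNReal.ofReal_mul hc, ENNReal.ofReal_mul hc',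
    ENNReal.ofReal_div_of_pos hnR, ENNReal.ofReal_div_of_pos hnR,
    ENNReal.ofReal_sub _ zero_le_one, ENNReal.ofReal_one, ENNReal.ofReal_natCast]
end
end

section
/- Let n be a positive integer, ρ a density matrix on the bipartite system R⊗A, and σ a density matrix on A. For each x ∈ {1,…,n} let τ_x = ρ^{RA_x} ⊗ (⊗_{i≠x} σ^{A_i}) on R⊗A₁⊗…⊗A_n (each A_i a copy of A), let τ = (1/n) Σ_{x=1}^n τ_x, and set μ := Q₂(ρ^{RA} ‖ ρ^R ⊗ σ) − 1, where ρ^R = Tr_A ρ. Then D₂(τ ‖ ρ^R ⊗ σ^{⊗n}) = log(1 + μ/n). -/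
open scoped Matrix Kronecker BigOperators ENNReal ComplexOrder Classical

noncomputable section

variable {d : Type*} [Fintype d] [DecidableEq d]

variable {R A : Type*} [Fintype R] [DecidableEq R] [Fintype A] [DecidableEq A]

/-! ### Functional calculus -/

lemma matFun_of_rep (U A : Matrix d d ℂ) (a : d → ℝ) (h1 : U * Uᴴ = 1) (h2 : Uᴴ * U = 1)
    (hA : A = U * Matrix.diagonal (fun i => (a i : ℂ)) * Uᴴ) (f : ℝ → ℝ) :
    matFun A f = U * Matrix.diagonal (fun i => (f (a i) : ℂ)) * Uᴴ := by
  have hh : A.IsHermitian := by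
    rw [hA]
    unfold Matrix.IsHermitian
    simp only [Matrix.conjTranspose_mul, Matrix.conjTranspose_conjTranspose,
      Matrix.diagonal_conjTranspose, Matrix.mul_assoc]
    congr 3
    ext i
    simp
  rw [matFun, dif_pos hh, herFun]
  set V : Matrix d d ℂ := (hh.eigenvectorUnitary : Matrix d d ℂ) with hV
  have v1 : V * Vᴴ = 1 := by
    have := Unitary.coe_mul_star_self hh.eigenvectorUnitary
    simpa [Matrix.star_eq_conjTranspose] using this
  have v2 : Vᴴ * V = 1 := by
    have := Unitary.coe_star_mul_self hh.eigenvectorUnitary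
    simpa [Matrix.star_eq_conjTranspose] using this
  have hs : A = V * Matrix.diagonal (fun i => (hh.eigenvalues i : ℂ)) * Vᴴ := by
    have := hh.spectral_theorem
    rw [Unitary.conjStarAlgAut_apply] at this
    exact this
  set e := hh.eigenvalues
  have hW : Vᴴ * U * Matrix.diagonal (fun i => (a i : ℂ))
      = Matrix.diagonal (fun i => (e i : ℂ)) * (Vᴴ * U) := by
    have h3 : Vᴴ * A * U = Vᴴ * U * Matrix.diagonal (fun i => (a i : ℂ)) := by
      rw [hA]
      simp only [Matrix.mul_assoc, h2, Matrix.mul_one]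
    have h4 : Vᴴ * A * U = Matrix.diagonal (fun i => (e i : ℂ)) * (Vᴴ * U) := by
      rw [hs]
      simp only [← Matrix.mul_assoc, v2, Matrix.one_mul]
    rw [← h3, h4]
  have hW2 : Vᴴ * U * Matrix.diagonal (fun i => (f (a i) : ℂ))
      = Matrix.diagonal (fun i => (f (e i) : ℂ)) * (Vᴴ * U) := by
    ext i j
    have := congrFun (congrFun hW i) j
    rw [Matrix.mul_diagonal, Matrix.diagonal_mul] at this ⊢
    by_cases h0 : (Vᴴ * U) i j = 0
    · simp [h0]
    · rw [mul_comm] at this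
      have h5 := mul_right_cancel₀ h0 this
      have h6 : a j = e i := by exact_mod_cast h5
      rw [h6, mul_comm]
  calc V * Matrix.diagonal (fun i => (f (e i) : ℂ)) * Vᴴ
      = V * (Matrix.diagonal (fun i => (f (e i) : ℂ)) * (Vᴴ * U)) * Uᴴ := by
        simp only [Matrix.mul_assoc, h1, Matrix.mul_one]
    _ = U * Matrix.diagonal (fun i => (f (a i) : ℂ)) * Uᴴ := by
        rw [← hW2]
        simp only [← Matrix.mul_assoc, v1, Matrix.one_mul]

/-- The power function used in `matPow`. -/
def pw (r : ℝ) (x : ℝ) : ℝ := if x = 0 then 0 else Real.rpow x r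

lemma pw_mul (r x y : ℝ) (hx : 0 ≤ x) (hy : 0 ≤ y) : pw r (x * y) = pw r x * pw r y := by
  unfold pw
  by_cases h1 : x = 0
  · simp [h1]
  by_cases h2 : y = 0
  · simp [h2]
  simp only [mul_eq_zero, h1, h2, or_self, if_false]
  exact Real.mul_rpow hx hy

lemma pw_add (r q x : ℝ) (hx : 0 ≤ x) : pw (r + q) x = pw r x * pw q x := by
  unfold pw
  by_cases h1 : x = 0
  · simp [h1]
  simp only [h1, if_false]
  exact Real.rpow_add (lt_of_le_of_ne hx (Ne.symm h1)) r q

lemma pw_one (x : ℝ) : pw 1 x = x := by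
  unfold pw
  by_cases h1 : x = 0
  · simp [h1]
  simp only [h1, if_false]
  exact Real.rpow_one x

lemma pw_prod (r : ℝ) {ι : Type*} (s : Finset ι) (f : ι → ℝ) (hf : ∀ i, 0 ≤ f i) :
    pw r (∏ i ∈ s, f i) = ∏ i ∈ s, pw r (f i) := by
  induction s using Finset.induction_on with
  | empty => simp [pw]
  | insert a s ha ih =>
    rw [Finset.prod_insert ha, Finset.prod_insert ha, pw_mul _ _ _ (hf a)
      (Finset.prod_nonneg fun i _ => hf i), ih]

/-- A unitary diagonalization with nonnegative eigenvalues. -/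
def IsRep (A U : Matrix d d ℂ) (a : d → ℝ) : Prop :=
  U * Uᴴ = 1 ∧ Uᴴ * U = 1 ∧ A = U * Matrix.diagonal (fun i => (a i : ℂ)) * Uᴴ ∧ ∀ i, 0 ≤ a i

lemma IsRep.pow {A U : Matrix d d ℂ} {a : d → ℝ} (h : IsRep A U a) (r : ℝ) :
    matPow A r = U * Matrix.diagonal (fun i => (pw r (a i) : ℂ)) * Uᴴ :=
  matFun_of_rep U A a h.1 h.2.1 h.2.2.1 _

lemma exists_rep {A : Matrix d d ℂ} (h : A.PosSemidef) : ∃ U a, IsRep A U a := by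
  have hh := h.isHermitian
  refine ⟨hh.eigenvectorUnitary, hh.eigenvalues, ?_, ?_, ?_, ?_⟩
  · have := Unitary.coe_mul_star_self hh.eigenvectorUnitary
    simpa [Matrix.star_eq_conjTranspose] using this
  · have := Unitary.coe_star_mul_self hh.eigenvectorUnitary
    simpa [Matrix.star_eq_conjTranspose] using this
  · have := hh.spectral_theorem
    rw [Unitary.conjStarAlgAut_apply] at this
    exact this
  · exact h.eigenvalues_nonneg

lemma matPow_add {A : Matrix d d ℂ} (h : A.PosSemidef) (r q : ℝ) :
    matPow A r * matPow A q = matPow A (r + q) := by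
  obtain ⟨U, a, hr⟩ := exists_rep h
  rw [hr.pow, hr.pow, hr.pow]
  have : U * Matrix.diagonal (fun i => (pw r (a i) : ℂ)) * Uᴴ *
      (U * Matrix.diagonal (fun i => (pw q (a i) : ℂ)) * Uᴴ)
      = U * (Matrix.diagonal (fun i => (pw r (a i) : ℂ)) * ((Uᴴ * U) *
        Matrix.diagonal (fun i => (pw q (a i) : ℂ)))) * Uᴴ := by
    simp only [Matrix.mul_assoc]
  rw [this, hr.2.1, Matrix.one_mul, Matrix.diagonal_mul_diagonal]
  congr 3
  ext i
  rw [pw_add _ _ _ (hr.2.2.2 i)]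
  push_cast
  rfl

lemma matPow_one {A : Matrix d d ℂ} (h : A.PosSemidef) : matPow A 1 = A := by
  obtain ⟨U, a, hr⟩ := exists_rep h
  rw [hr.pow]
  simp only [pw_one]
  exact hr.2.2.1.symm

lemma matPow_herm {A : Matrix d d ℂ} (h : A.PosSemidef) (r : ℝ) :
    (matPow A r)ᴴ = matPow A r := by
  obtain ⟨U, a, hr⟩ := exists_rep h
  rw [hr.pow]
  simp only [Matrix.conjTranspose_mul, Matrix.conjTranspose_conjTranspose,
      Matrix.diagonal_conjTranspose, Matrix.mul_assoc]
  congr 3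
  ext i
  simp

lemma matPow_kron {A : Matrix R R ℂ} {B : Matrix d d ℂ} (hA : A.PosSemidef)
    {U : Matrix d d ℂ} {b : d → ℝ} (hB : IsRep B U b) (r : ℝ) :
    matPow (A ⊗ₖ B) r = matPow A r ⊗ₖ matPow B r := by
  obtain ⟨V, a, ha⟩ := exists_rep hA
  have hr : IsRep (A ⊗ₖ B) (V ⊗ₖ U) (fun p => a p.1 * b p.2) := by
    refine ⟨?_, ?_, ?_, ?_⟩
    · rw [Matrix.conjTranspose_kronecker, ← Matrix.mul_kronecker_mul, ha.1, hB.1,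
        Matrix.one_kronecker_one]
    · rw [Matrix.conjTranspose_kronecker, ← Matrix.mul_kronecker_mul, ha.2.1, hB.2.1,
        Matrix.one_kronecker_one]
    · rw [Matrix.conjTranspose_kronecker]
      conv_lhs => rw [ha.2.2.1, hB.2.2.1]
      rw [Matrix.mul_kronecker_mul, Matrix.mul_kronecker_mul, Matrix.diagonal_kronecker_diagonal]
      push_cast
      rfl
    · exact fun p => mul_nonneg (ha.2.2.2 _) (hB.2.2.2 _)
  rw [hr.pow, ha.pow, hB.pow, Matrix.mul_kronecker_mul, Matrix.mul_kronecker_mul,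
    Matrix.diagonal_kronecker_diagonal, Matrix.conjTranspose_kronecker]
  congr 3
  ext p
  rw [pw_mul _ _ _ (ha.2.2.2 _) (hB.2.2.2 _)]
  push_cast
  rfl

/-! ### Product matrices -/

/-- Tensor product of a family of matrices. -/
def pt {n : ℕ} (M : Fin n → Matrix A A ℂ) : Matrix (Fin n → A) (Fin n → A) ℂ :=
  Matrix.of fun v w => ∏ k, M k (v k) (w k)

lemma tpow_eq_pt (σ : Matrix A A ℂ) (n : ℕ) : tpow σ n = pt (fun _ => σ) := rfl

lemma pt_mul {n : ℕ} (M N : Fin n → Matrix A A ℂ) : pt M * pt N = pt (fun k => M k * N k) := by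
  ext v w
  simp only [pt, Matrix.mul_apply, Matrix.of_apply]
  rw [Finset.prod_univ_sum, Fintype.piFinset_univ]
  simp only [Finset.prod_mul_distrib]

lemma pt_trace {n : ℕ} (M : Fin n → Matrix A A ℂ) : (pt M).trace = ∏ k, (M k).trace := by
  simp only [pt, Matrix.trace, Matrix.diag, Matrix.of_apply]
  rw [Finset.prod_univ_sum, Fintype.piFinset_univ]

lemma pt_diag {n : ℕ} (a : A → ℂ) : pt (fun _ : Fin n => Matrix.diagonal a)
    = Matrix.diagonal (fun v => ∏ k, a (v k)) := by
  ext v w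
  simp only [pt, Matrix.of_apply]
  by_cases h : v = w
  · subst h
    simp
  · rw [Matrix.diagonal_apply_ne _ h]
    obtain ⟨k, hk⟩ := Function.ne_iff.mp h
    exact Finset.prod_eq_zero (Finset.mem_univ k) (Matrix.diagonal_apply_ne _ hk)

lemma pt_one {n : ℕ} : pt (fun _ : Fin n => (1 : Matrix A A ℂ)) = 1 := by
  have := pt_diag (n := n) (fun _ : A => (1 : ℂ))
  simpa using this

lemma pt_conj {n : ℕ} (M : Fin n → Matrix A A ℂ) : (pt M)ᴴ = pt (fun k => (M k)ᴴ) := by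
  ext v w
  simp [pt, Matrix.conjTranspose_apply]

lemma rep_tpow {σ U : Matrix A A ℂ} {a : A → ℝ} (h : IsRep σ U a) (n : ℕ) :
    IsRep (tpow σ n) (tpow U n) (fun v => ∏ k, a (v k)) := by
  simp only [tpow_eq_pt]
  refine ⟨?_, ?_, ?_, ?_⟩
  · rw [pt_conj, pt_mul, h.1, pt_one]
  · rw [pt_conj, pt_mul, h.2.1, pt_one]
  · push_cast
    rw [← pt_diag (fun i => (a i : ℂ)), pt_conj, pt_mul, pt_mul, ← h.2.2.1]
  · exact fun v => Finset.prod_nonneg fun k _ => h.2.2.2 _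

lemma matPow_tpow {σ U : Matrix A A ℂ} {a : A → ℝ} (h : IsRep σ U a) (n : ℕ) (r : ℝ) :
    matPow (tpow σ n) r = tpow (matPow σ r) n := by
  rw [(rep_tpow h n).pow, h.pow]
  simp only [tpow_eq_pt]
  rw [← pt_mul, ← pt_mul, pt_conj, pt_diag]
  congr 3
  ext v
  rw [pw_prod _ _ _ (fun k => h.2.2.2 _)]
  push_cast
  rfl

/-! ### Blocks -/

/-- The `(i, j)` block of a matrix on `R × α`. -/
def blk {α : Type*} (M : Matrix (R × α) (R × α) ℂ) (i j : R) : Matrix α α ℂ :=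
  Matrix.of fun a b => M (i, a) (j, b)

lemma blk_mul {α : Type*} [Fintype α] (M N : Matrix (R × α) (R × α) ℂ) (i j : R) :
    blk (M * N) i j = ∑ k, blk M i k * blk N k j := by
  ext a b
  simp [blk, Matrix.mul_apply, Matrix.sum_apply, Fintype.sum_prod_type]

lemma blk_kron {α : Type*} (T : Matrix R R ℂ) (s : Matrix α α ℂ) (i j : R) :
    blk (T ⊗ₖ s) i j = T i j • s := by
  ext a b
  simp [blk]

lemma blk_ext {α : Type*} {M N : Matrix (R × α) (R × α) ℂ} (h : ∀ i j, blk M i j = blk N i j) :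
    M = N := by
  ext ⟨i, a⟩ ⟨j, b⟩
  exact congrFun (congrFun (h i j) a) b

lemma trace_blk {α : Type*} [Fintype α] (M : Matrix (R × α) (R × α) ℂ) :
    M.trace = ∑ i, (blk M i i).trace := by
  simp [Matrix.trace, blk, Fintype.sum_prod_type]

lemma trace_block_formula {α : Type*} [Fintype α] (M N : Matrix (R × α) (R × α) ℂ)
    (T : Matrix R R ℂ) (s : Matrix α α ℂ) :
    (M * (T ⊗ₖ s) * N * (T ⊗ₖ s)).trace
      = ∑ i, ∑ k, ∑ l, ∑ j, T j k * T l i * (blk M i j * s * blk N k l * s).trace := by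
  rw [Matrix.mul_assoc (M * (T ⊗ₖ s)), trace_blk]
  refine Finset.sum_congr rfl fun i _ => ?_
  rw [blk_mul, Matrix.trace_sum]
  refine Finset.sum_congr rfl fun k _ => ?_
  rw [blk_mul, blk_mul]
  simp only [blk_kron, Finset.mul_sum, Finset.sum_mul, Matrix.trace_sum]
  refine Finset.sum_congr rfl fun l _ => Finset.sum_congr rfl fun j _ => ?_
  simp only [Matrix.mul_smul, Matrix.smul_mul, Matrix.trace_smul, smul_eq_mul, Matrix.mul_assoc]
  ring

lemma ptrace2_eq (ρ : Matrix (R × A) (R × A) ℂ) (i j : R) :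
    ptrace2 ρ i j = (blk ρ i j).trace := rfl

lemma blk_tauX (ρ : Matrix (R × A) (R × A) ℂ) (σ : Matrix A A ℂ) (n : ℕ) (x : Fin n) (i j : R) :
    blk (tauX ρ σ n x) i j = pt (Function.update (fun _ => σ) x (blk ρ i j)) := by
  ext v w
  simp only [blk, tauX, pt, Matrix.of_apply]
  rw [← Finset.mul_prod_erase Finset.univ _ (Finset.mem_univ x)]
  congr 1
  · simp
  · refine Finset.prod_congr rfl fun k hk => ?_
    rw [Function.update_of_ne (Finset.ne_of_mem_erase hk)]

lemma kron_sub_left (M N : Matrix R R ℂ) (B : Matrix A A ℂ) :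
    (M - N) ⊗ₖ B = M ⊗ₖ B - N ⊗ₖ B := by
  ext p q
  simp [sub_mul]

lemma kron_sub_right (B : Matrix R R ℂ) (M N : Matrix A A ℂ) :
    B ⊗ₖ (M - N) = B ⊗ₖ M - B ⊗ₖ N := by
  ext p q
  simp [mul_sub]

lemma pt_update_apply {n : ℕ} (M : Fin n → Matrix A A ℂ) (x : Fin n) (B : Matrix A A ℂ)
    (v w : Fin n → A) : pt (Function.update M x B) v w
      = B (v x) (w x) * ∏ k ∈ Finset.univ.erase x, M k (v k) (w k) := by
  simp only [pt, Matrix.of_apply]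
  rw [← Finset.mul_prod_erase Finset.univ _ (Finset.mem_univ x)]
  congr 1
  · simp
  · refine Finset.prod_congr rfl fun k hk => ?_
    rw [Function.update_of_ne (Finset.ne_of_mem_erase hk)]

lemma pt_update_sum {n : ℕ} (M : Fin n → Matrix A A ℂ) (x : Fin n) {ι : Type*} (s : Finset ι)
    (c : ι → ℂ) (B : ι → Matrix A A ℂ) :
    ∑ k ∈ s, c k • pt (Function.update M x (B k))
      = pt (Function.update M x (∑ k ∈ s, c k • B k)) := by
  ext v w
  rw [pt_update_apply]
  simp only [Matrix.sum_apply, Matrix.smul_apply, pt_update_apply, smul_eq_mul, Finset.sum_mul,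
    mul_assoc]

lemma tauX_mul_s1 (ρ : Matrix (R × A) (R × A) ℂ) (σ : Matrix A A ℂ) (n : ℕ) (x : Fin n)
    (W : Matrix R R ℂ) (P : Matrix A A ℂ) (h1 : ρ * (W ⊗ₖ P) = ρ) (h2 : σ * P = σ) :
    tauX ρ σ n x * (W ⊗ₖ tpow P n) = tauX ρ σ n x := by
  apply blk_ext
  intro i j
  rw [blk_mul, blk_tauX]
  have h3 : blk ρ i j = ∑ k, W k j • (blk ρ i k * P) := by
    conv_lhs => rw [← h1]
    rw [blk_mul]
    simp only [blk_kron, Matrix.mul_smul]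
  rw [h3, ← pt_update_sum]
  refine Finset.sum_congr rfl fun k _ => ?_
  rw [blk_kron, blk_tauX, Matrix.mul_smul, tpow_eq_pt, pt_mul]
  congr 2
  funext m
  by_cases hm : m = x
  · subst hm
    simp
  · simp [Function.update_of_ne hm, h2]

lemma suppLE_of_proj {ρ M : Matrix d d ℂ} (hM : M.PosSemidef)
    (h : ρ * matPow M 0 = ρ) : suppLE ρ M := by
  intro v hv
  simp only [LinearMap.mem_ker, Matrix.mulVecLin_apply] at hv ⊢
  have h0 : matPow M 0 = matPow M (-1) * M := by
    conv_rhs => rw [← matPow_one hM, matPow_one hM]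
    nth_rewrite 3 [← matPow_one hM]
    rw [matPow_add hM]
    norm_num
  rw [← h, h0, ← Matrix.mul_assoc, ← Matrix.mulVec_mulVec, hv, Matrix.mulVec_zero]

lemma suppLE_mul {ρ M N : Matrix d d ℂ} (h : suppLE ρ M) (hN : M * N = 0) : ρ * N = 0 := by
  ext i j
  have h1 : M *ᵥ (fun k => N k j) = 0 := by
    funext k
    exact congrFun (congrFun hN k) j
  have h2 : (fun k => N k j) ∈ LinearMap.ker ρ.mulVecLin := h (by simpa using h1)
  have h3 : ρ *ᵥ (fun k => N k j) = 0 := by simpa using h2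
  exact congrFun h3 i

lemma mul_proj {M : Matrix d d ℂ} (hM : M.PosSemidef) : M * matPow M 0 = M := by
  nth_rewrite 1 [← matPow_one hM]
  rw [matPow_add hM, add_zero, matPow_one hM]

lemma proj_of_suppLE {ρ M : Matrix d d ℂ} (hM : M.PosSemidef)
    (h : suppLE ρ M) : ρ * matPow M 0 = ρ := by
  have : ρ * (1 - matPow M 0) = 0 := by
    apply suppLE_mul h
    rw [Matrix.mul_sub, mul_proj hM, Matrix.mul_one, sub_self]
  rw [Matrix.mul_sub, Matrix.mul_one, sub_eq_zero] at this
  exact this.symm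

lemma mul_eq_zero_of_trace {ρ Q : Matrix d d ℂ} (hρ : ρ.PosSemidef) (hQ : Qᴴ = Q) (hQ2 : Q * Q = Q)
    (h : (ρ * Q).trace = 0) : ρ * Q = 0 := by
  have hs : ρ = matPow ρ (1/2) * matPow ρ (1/2) := by
    rw [matPow_add hρ]
    norm_num [matPow_one hρ]
  have hh := matPow_herm hρ (1/2)
  set B := matPow ρ (1/2)
  have h1 : ((B * Q)ᴴ * (B * Q)).trace = 0 := by
    rw [Matrix.conjTranspose_mul, hQ, hh, Matrix.trace_mul_comm]
    have : B * Q * (Q * B) = B * (Q * Q) * B := by simp only [Matrix.mul_assoc]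
    rw [this, hQ2, Matrix.trace_mul_comm, ← Matrix.mul_assoc, ← hs, h]
  rw [Matrix.trace_conjTranspose_mul_self_eq_zero_iff] at h1
  rw [hs, Matrix.mul_assoc, h1, Matrix.mul_zero]

lemma proj_herm {M : Matrix d d ℂ} (hM : M.PosSemidef) :
    (1 - matPow M 0)ᴴ = 1 - matPow M 0 := by
  rw [Matrix.conjTranspose_sub, matPow_herm hM, Matrix.conjTranspose_one]

lemma proj_idem {M : Matrix d d ℂ} (hM : M.PosSemidef) :
    (1 - matPow M 0) * (1 - matPow M 0) = 1 - matPow M 0 := by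
  rw [Matrix.mul_sub, Matrix.sub_mul, Matrix.sub_mul, matPow_add hM]
  simp

lemma sandwich {M : Matrix d d ℂ} (hM : M.PosSemidef) :
    matPow M (-(1/2)) * M * matPow M (-(1/2)) = matPow M 0 := by
  nth_rewrite 2 [← matPow_one hM]
  rw [matPow_add hM, matPow_add hM]
  norm_num

lemma trace_self {M : Matrix d d ℂ} (hM : M.PosSemidef) :
    (M * matPow M (-(1/2)) * M * matPow M (-(1/2))).trace = M.trace := by
  rw [Matrix.mul_assoc, Matrix.mul_assoc, ← Matrix.mul_assoc (matPow _ _), sandwich hM, mul_proj hM]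

lemma one_le_Q2R {ρ M : Matrix d d ℂ} (hρ : IsDensity ρ) (hM : IsDensity M)
    (h : ρ * matPow M 0 = ρ) : 1 ≤ Q2R ρ M := by
  have ht : matPow M (-(1/2)) = matPow M (-(1/4)) * matPow M (-(1/4)) := by
    rw [matPow_add hM.1]; norm_num
  have hh := matPow_herm hM.1 (-(1/4))
  have hss := sandwich hM.1
  have hts := trace_self hM.1
  rw [Q2R]
  set S := matPow M (-(1/2))
  set t := matPow M (-(1/4))
  set X := ρ - M with hX
  have hXh : Xᴴ = X := by
    rw [hX, Matrix.conjTranspose_sub, hρ.1.isHermitian.eq, hM.1.isHermitian.eq]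
  have h1 : 0 ≤ (X * S * X * S).trace := by
    have h2 : (X * S * X * S).trace = ((t * X * t)ᴴ * (t * X * t)).trace := by
      rw [Matrix.conjTranspose_mul, Matrix.conjTranspose_mul, hXh, hh, ht]
      have : t * (X * t) * (t * X * t) = t * (X * (t * t) * X * t) := by
        simp only [Matrix.mul_assoc]
      rw [this, Matrix.trace_mul_comm t]
      simp only [Matrix.mul_assoc]
    rw [h2]
    exact (Matrix.posSemidef_conjTranspose_mul_self _).trace_nonneg
  have h3 : (ρ * S * M * S).trace = 1 := by
    rw [Matrix.mul_assoc, Matrix.mul_assoc, ← Matrix.mul_assoc S, hss, h, hρ.2]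
  have h4 : (M * S * ρ * S).trace = 1 := by
    rw [Matrix.mul_assoc (M * S), Matrix.trace_mul_comm, ← Matrix.mul_assoc, h3]
  have h5 : (X * S * X * S).trace = (ρ * S * ρ * S).trace - 1 := by
    have : X * S * X * S = ρ * S * ρ * S - ρ * S * M * S - (M * S * ρ * S - M * S * M * S) := by
      rw [hX]
      simp only [Matrix.sub_mul, Matrix.mul_sub]
      abel
    rw [this, Matrix.trace_sub, Matrix.trace_sub, Matrix.trace_sub, h3, h4, hts, hM.2]
    ring
  rw [h5] at h1
  have := (Complex.le_def.mp h1).1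
  simp only [Complex.zero_re, Complex.sub_re, Complex.one_re] at this
  linarith

lemma ptrace2_density {ρ : Matrix (R × A) (R × A) ℂ} (hρ : IsDensity ρ) :
    IsDensity (ptrace2 ρ) := by
  constructor
  · have : ptrace2 ρ = ∑ a : A, ρ.submatrix (fun i => (i, a)) (fun i => (i, a)) := by
      ext i j
      simp [ptrace2, Matrix.sum_apply]
    rw [this]
    exact Matrix.posSemidef_sum _ fun a _ => hρ.1.submatrix _
  · rw [← hρ.2, trace_blk]
    rfl

lemma trace_mul_kron_one (ρ : Matrix (R × A) (R × A) ℂ) (W : Matrix R R ℂ) :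
    (ρ * (W ⊗ₖ (1 : Matrix A A ℂ))).trace = (ptrace2 ρ * W).trace := by
  rw [trace_blk]
  simp only [blk_mul, blk_kron, Matrix.trace_sum, Matrix.mul_smul, Matrix.mul_one,
    Matrix.trace_smul, smul_eq_mul]
  rw [Matrix.trace]
  simp only [Matrix.diag, Matrix.mul_apply, ptrace2_eq]
  exact Finset.sum_congr rfl fun i _ => Finset.sum_congr rfl fun j _ => mul_comm _ _

lemma mul_omega_proj {ρ : Matrix (R × A) (R × A) ℂ} (hρ : IsDensity ρ) :
    ρ * (matPow (ptrace2 ρ) 0 ⊗ₖ (1 : Matrix A A ℂ)) = ρ := by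
  have hω := ptrace2_density hρ
  have h : ρ * ((1 - matPow (ptrace2 ρ) 0) ⊗ₖ (1 : Matrix A A ℂ)) = 0 := by
    apply mul_eq_zero_of_trace hρ.1
    · rw [Matrix.conjTranspose_kronecker, proj_herm hω.1, Matrix.conjTranspose_one]
    · rw [← Matrix.mul_kronecker_mul, proj_idem hω.1, Matrix.one_mul]
    · rw [trace_mul_kron_one, Matrix.mul_sub, mul_proj hω.1, Matrix.mul_one, sub_self,
        Matrix.trace_zero]
  rw [kron_sub_left, Matrix.one_kronecker_one, Matrix.mul_sub, Matrix.mul_one,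
    sub_eq_zero] at h
  exact h.symm

lemma trace_mul_one_kron {α : Type*} [Fintype α] (M : Matrix (R × α) (R × α) ℂ)
    (s : Matrix α α ℂ) :
    (M * ((1 : Matrix R R ℂ) ⊗ₖ s)).trace = ∑ i, (blk M i i * s).trace := by
  rw [trace_blk]
  refine Finset.sum_congr rfl fun i _ => ?_
  rw [blk_mul]
  simp only [blk_kron]
  rw [Finset.sum_eq_single i]
  · simp
  · intro b _ hb
    simp [Matrix.one_apply_ne hb]
  · simp

lemma mul_sigma_proj {ρ : Matrix (R × A) (R × A) ℂ} (hρ : IsDensity ρ)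
    {σ : Matrix A A ℂ} (hσ : IsDensity σ) (n : ℕ) (hn : 0 < n)
    (h : suppLE ((n : ℂ)⁻¹ • ∑ x : Fin n, tauX ρ σ n x) (ptrace2 ρ ⊗ₖ tpow σ n)) :
    ρ * ((1 : Matrix R R ℂ) ⊗ₖ matPow σ 0) = ρ := by
  have hz : σ * (1 - matPow σ 0) = 0 := by
    rw [Matrix.mul_sub, mul_proj hσ.1, Matrix.mul_one, sub_self]
  let x0 : Fin n := ⟨0, hn⟩
  set N := (1 : Matrix R R ℂ) ⊗ₖ
    pt (Function.update (fun _ : Fin n => (1 : Matrix A A ℂ)) x0 (1 - matPow σ 0)) with hN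
  have h1 : (ptrace2 ρ ⊗ₖ tpow σ n) * N = 0 := by
    rw [hN, ← Matrix.mul_kronecker_mul, tpow_eq_pt, pt_mul]
    have : pt (fun k => σ * Function.update (fun _ : Fin n => (1 : Matrix A A ℂ)) x0
        (1 - matPow σ 0) k) = 0 := by
      ext v w
      simp only [pt, Matrix.of_apply, Matrix.zero_apply]
      apply Finset.prod_eq_zero (Finset.mem_univ x0)
      simp [hz]
    rw [this, Matrix.kronecker_zero]
  have h2 := suppLE_mul h h1
  have h3 : ((∑ x : Fin n, tauX ρ σ n x) * N).trace = 0 := by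
    rw [Matrix.smul_mul] at h2
    have hc : (n : ℂ)⁻¹ ≠ 0 := by
      simp [hn.ne']
    rw [(smul_eq_zero.mp h2).resolve_left hc, Matrix.trace_zero]
  have h4 : ∀ x : Fin n, (tauX ρ σ n x * N).trace
      = if x = x0 then (ρ * ((1 : Matrix R R ℂ) ⊗ₖ (1 - matPow σ 0))).trace else 0 := by
    intro x
    rw [hN, trace_mul_one_kron]
    simp only [blk_tauX, pt_mul, pt_trace]
    split_ifs with hx
    · rw [trace_mul_one_kron]
      refine Finset.sum_congr rfl fun i _ => ?_
      rw [Fintype.prod_eq_single x0]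
      · simp [hx]
      · intro y hy
        subst hx
        simp [Function.update_of_ne hy, hσ.2]
    · refine Finset.sum_eq_zero fun i _ => ?_
      apply Finset.prod_eq_zero (Finset.mem_univ x0)
      rw [Function.update_of_ne (Ne.symm hx), Function.update_self, hz, Matrix.trace_zero]
  rw [Finset.sum_mul, Matrix.trace_sum] at h3
  simp only [h4, Finset.sum_ite_eq', Finset.mem_univ, if_true] at h3
  have h5 := mul_eq_zero_of_trace hρ.1 (by
    rw [Matrix.conjTranspose_kronecker, proj_herm hσ.1, Matrix.conjTranspose_one]) (by
    rw [← Matrix.mul_kronecker_mul, proj_idem hσ.1, Matrix.one_mul]) h3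
  rw [kron_sub_right, Matrix.one_kronecker_one, Matrix.mul_sub, Matrix.mul_one,
    sub_eq_zero] at h5
  exact h5.symm

lemma trace_tau_tau (ρ : Matrix (R × A) (R × A) ℂ) (hρ : IsDensity ρ)
    (σ : Matrix A A ℂ) (hσ : IsDensity σ) (n : ℕ)
    (h : ρ * ((1 : Matrix R R ℂ) ⊗ₖ matPow σ 0) = ρ) (x y : Fin n) :
    (tauX ρ σ n x * (matPow (ptrace2 ρ) (-(1/2)) ⊗ₖ tpow (matPow σ (-(1/2))) n) * tauX ρ σ n y
      * (matPow (ptrace2 ρ) (-(1/2)) ⊗ₖ tpow (matPow σ (-(1/2))) n)).trace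
    = if x = y then (ρ * (matPow (ptrace2 ρ) (-(1/2)) ⊗ₖ matPow σ (-(1/2))) * ρ
      * (matPow (ptrace2 ρ) (-(1/2)) ⊗ₖ matPow σ (-(1/2)))).trace else 1 := by
  have hω := ptrace2_density hρ
  have hss := sandwich hσ.1
  have hts := trace_self hσ.1
  have htω := trace_self hω.1
  set T := matPow (ptrace2 ρ) (-(1/2))
  set s := matPow σ (-(1/2))
  have hb : ∀ i j, blk ρ i j * matPow σ 0 = blk ρ i j := by
    intro i j
    conv_rhs => rw [← h]
    rw [blk_mul, Finset.sum_eq_single j]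
    · rw [blk_kron]; simp
    · intro b _ hb
      rw [blk_kron]; simp [Matrix.one_apply_ne hb]
    · simp
  rw [trace_block_formula]
  simp only [blk_tauX, tpow_eq_pt, pt_mul, pt_trace]
  split_ifs with hxy
  · subst hxy
    rw [trace_block_formula]
    refine Finset.sum_congr rfl fun i _ => Finset.sum_congr rfl fun k _ =>
      Finset.sum_congr rfl fun l _ => Finset.sum_congr rfl fun j _ => ?_
    rw [Fintype.prod_eq_single x]
    · simp
    · intro m hm
      simp [Function.update_of_ne hm, hts, hσ.2]
  · rw [← hω.2, ← htω]
    have e1 : ∀ i j k l, (∏ m, (Function.update (fun _ => σ) x (blk ρ i j) m * s *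
        Function.update (fun _ => σ) y (blk ρ k l) m * s).trace)
        = ptrace2 ρ i j * ptrace2 ρ k l := by
      intro i j k l
      rw [Fintype.prod_eq_mul x y hxy]
      · rw [Function.update_self, Function.update_self, Function.update_of_ne hxy,
          Function.update_of_ne (Ne.symm hxy)]
        rw [Matrix.mul_assoc, Matrix.mul_assoc, ← Matrix.mul_assoc s, hss, hb, ptrace2_eq,
          ptrace2_eq, Matrix.mul_assoc (σ * s), Matrix.trace_mul_comm, ← Matrix.mul_assoc,
          Matrix.mul_assoc, Matrix.mul_assoc, ← Matrix.mul_assoc s, hss, hb]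
      · rintro m ⟨h1, h2⟩
        simp [Function.update_of_ne h1, Function.update_of_ne h2, hts, hσ.2]
    simp only [e1]
    rw [Matrix.mul_assoc (ptrace2 ρ * T), Matrix.trace]
    simp only [Matrix.diag, Matrix.mul_apply, Finset.sum_mul, Finset.mul_sum]
    refine Finset.sum_congr rfl fun i _ => Finset.sum_congr rfl fun k _ =>
      Finset.sum_congr rfl fun l _ => Finset.sum_congr rfl fun j _ => ?_
    ring

/-- **Equality-based convex split lemma, `D₂` form** (with `ω = ρ^R`):
`D₂(τ ‖ ρ^R ⊗ σ^{⊗n}) = log(1 + μ/n)` where `μ = Q₂(ρ^{RA} ‖ ρ^R ⊗ σ) − 1`. -/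
theorem convex_split_equality_D2 (n : ℕ) (hn : 0 < n)
    (ρ : Matrix (R × A) (R × A) ℂ) (hρ : IsDensity ρ)
    (σ : Matrix A A ℂ) (hσ : IsDensity σ) :
    D2 ((n : ℂ)⁻¹ • ∑ x : Fin n, tauX ρ σ n x) (ptrace2 ρ ⊗ₖ tpow σ n)
      = ENNReal.log (1 + (Q2 ρ (ptrace2 ρ ⊗ₖ σ) - 1) / n) := by
  have hω := ptrace2_density hρ
  obtain ⟨U, a, hU⟩ := exists_rep hσ.1
  have hn0 : (n : ℝ) ≠ 0 := by exact_mod_cast hn.ne'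
  have hn1 : (n : ℝ≥0∞) ≠ 0 := by exact_mod_cast hn.ne'
  have hk : ∀ r, matPow (ptrace2 ρ ⊗ₖ σ) r = matPow (ptrace2 ρ) r ⊗ₖ matPow σ r :=
    fun r => matPow_kron hω.1 hU r
  have hkn : ∀ r, matPow (ptrace2 ρ ⊗ₖ tpow σ n) r
      = matPow (ptrace2 ρ) r ⊗ₖ tpow (matPow σ r) n := fun r => by
    rw [matPow_kron hω.1 (rep_tpow hU n) r, matPow_tpow hU]
  have hMd : IsDensity (ptrace2 ρ ⊗ₖ σ) :=
    ⟨hω.1.kronecker hσ.1, by rw [Matrix.trace_kronecker, hω.2, hσ.2, one_mul]⟩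
  have hMn : (ptrace2 ρ ⊗ₖ tpow σ n).PosSemidef := by
    refine hω.1.kronecker ?_
    obtain ⟨h1, h2, h3, h4⟩ := rep_tpow hU n
    rw [h3]
    exact (Matrix.PosSemidef.diagonal (fun v => by
      simpa using Complex.zero_le_real.mpr (h4 v))).mul_mul_conjTranspose_same _
  have hiff : suppLE ((n : ℂ)⁻¹ • ∑ x : Fin n, tauX ρ σ n x) (ptrace2 ρ ⊗ₖ tpow σ n)
      ↔ suppLE ρ (ptrace2 ρ ⊗ₖ σ) := by
    constructor
    · intro h
      have h1 := mul_sigma_proj hρ hσ n hn h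
      have h2 := mul_omega_proj hρ
      apply suppLE_of_proj hMd.1
      rw [hk]
      have : matPow (ptrace2 ρ) 0 ⊗ₖ matPow σ 0 = (matPow (ptrace2 ρ) 0 ⊗ₖ (1 : Matrix A A ℂ))
          * ((1 : Matrix R R ℂ) ⊗ₖ matPow σ 0) := by
        rw [← Matrix.mul_kronecker_mul, Matrix.mul_one, Matrix.one_mul]
      rw [this, ← Matrix.mul_assoc, h2, h1]
    · intro h
      have h1 := proj_of_suppLE hMd.1 h
      rw [hk] at h1
      apply suppLE_of_proj hMn
      rw [hkn, Matrix.smul_mul, Finset.sum_mul]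
      congr 1
      exact Finset.sum_congr rfl fun x _ => tauX_mul_s1 ρ σ n x _ _ h1 (mul_proj hσ.1)
  unfold D2
  congr 1
  unfold Q2
  by_cases hs : suppLE ρ (ptrace2 ρ ⊗ₖ σ)
  · rw [if_pos hs, if_pos (hiff.mpr hs)]
    have h1 := mul_sigma_proj hρ hσ n hn (hiff.mpr hs)
    have hq := one_le_Q2R hρ hMd (proj_of_suppLE hMd.1 hs)
    have hmain : Q2R ((n : ℂ)⁻¹ • ∑ x : Fin n, tauX ρ σ n x) (ptrace2 ρ ⊗ₖ tpow σ n)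
        = 1 + (Q2R ρ (ptrace2 ρ ⊗ₖ σ) - 1) / n := by
      unfold Q2R
      rw [hk, hkn]
      have ht := trace_tau_tau ρ hρ σ hσ n h1
      set q := (ρ * (matPow (ptrace2 ρ) (-(1/2)) ⊗ₖ matPow σ (-(1/2))) * ρ
        * (matPow (ptrace2 ρ) (-(1/2)) ⊗ₖ matPow σ (-(1/2)))).trace
      have e : ∀ x y : Fin n, (if x = y then q else 1) = 1 + (if x = y then q - 1 else 0) := by
        intro x y
        split_ifs <;> ring
      simp only [Matrix.smul_mul, Matrix.mul_smul, Matrix.trace_smul, smul_eq_mul]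
      have hsum : ∀ S : Matrix (R × (Fin n → A)) (R × (Fin n → A)) ℂ,
          ((∑ x : Fin n, tauX ρ σ n x) * S * (∑ y : Fin n, tauX ρ σ n y) * S).trace
          = ∑ y : Fin n, ∑ x : Fin n, (tauX ρ σ n x * S * tauX ρ σ n y * S).trace := by
        intro S
        simp only [Finset.sum_mul, Finset.mul_sum, Matrix.trace_sum]
      rw [hsum]
      simp only [ht, e]
      simp only [Finset.sum_add_distrib, Finset.sum_ite_eq, Finset.sum_ite_eq', Finset.mem_univ,
        if_true, Finset.sum_const, Finset.card_univ, Fintype.card_fin, nsmul_eq_mul, mul_one]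
      have hnc : (n : ℂ) ≠ 0 := by exact_mod_cast hn.ne'
      have : (n : ℂ)⁻¹ * ((n : ℂ)⁻¹ * ((n : ℂ) * (n : ℂ) + (n : ℂ) * (q - 1)))
          = 1 + (q - 1) / ((n : ℝ) : ℂ) := by
        push_cast
        field_simp
      rw [this, Complex.add_re, Complex.div_ofReal_re]
      simp
    rw [hmain, ENNReal.ofReal_add zero_le_one (div_nonneg (by linarith) (Nat.cast_nonneg n)),
      ENNReal.ofReal_div_of_pos (by positivity), ENNReal.ofReal_sub _ zero_le_one]
    simp
  · rw [if_neg hs, if_neg (fun h => hs (hiff.mp h))]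
    rw [ENNReal.top_sub (by simp), ENNReal.top_div_of_ne_top (by simp)]
    simp
end
end
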